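/- Let k ⊂ k_n be an extension of finite fields of degree n, ψ a nontrivial additive character of k, and λ ∈ k^×. Then Σ_{y ∈ k_n^×, N_{k_n/k}(y) = λ} ψ(Tr_{k_n/k}(y)) = (-1)^{n-1} K_{n,λ}(ψ), where K_{n,λ}(ψ) = Σ_{ζ_1⋯ζ_n = λ, ζ_i ∈ k^×} ψ(ζ_1 + ⋯ + ζ_n). -/

import Mathlib

open Finset

/-- The generalized Kloosterman sum `K_{n,a}(ψ)`, the sum of `ψ(ζ₁ + ⋯ + ζₙ)`
over `n`-tuples `(ζ₁, …, ζₙ)` of elements of `kˣ` with product `a`. -/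
noncomputable def kloosterman {k : Type*} [Field k] [Fintype k] [DecidableEq k]
    (ψ : k → ℂ) (n : ℕ) (a : kˣ) : ℂ :=
  ∑ ζ ∈ Finset.univ.filter (fun ζ : Fin n → kˣ => (∏ i, ((ζ i : k))) = (a : k)),
    ψ (∑ i, ((ζ i : k)))

open Polynomial UniqueFactorizationMonoid

section MonicPolynomials

variable (k : Type*) [Field k] [Finite k]

lemma finite_monic_natDegree_eq (d : ℕ) : {f : k[X] | f.Monic ∧ f.natDegree = d}.Finite := by
  have : Finite (degreeLT k (d + 1)) :=
    Finite.of_equiv _ (degreeLTEquiv k (d + 1)).symm.toEquiv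
  refine (Set.toFinite (degreeLT k (d + 1) : Set k[X])).subset fun f hf ↦ ?_
  rw [SetLike.mem_coe, mem_degreeLT]
  exact (degree_le_natDegree).trans_lt (by rw [hf.2]; exact_mod_cast Nat.lt_succ_self d)

/-- The monic polynomials of degree `d` over a finite field. -/
noncomputable def monicOfDegree (d : ℕ) : Finset k[X] :=
  (finite_monic_natDegree_eq k d).toFinset

open Classical in
/-- The pairs `(P, i)` with `P` monic irreducible of degree at most `N` and `1 ≤ i ≤ N`. -/
noncomputable def primePowerPairs (N : ℕ) : Finset (k[X] × ℕ) :=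
  (((range (N + 1)).biUnion (monicOfDegree k)).filter Irreducible) ×ˢ Icc 1 N

variable {k}

@[simp]
lemma mem_monicOfDegree {d : ℕ} {f : k[X]} :
    f ∈ monicOfDegree k d ↔ f.Monic ∧ f.natDegree = d := by
  simp [monicOfDegree]

lemma mem_primePowerPairs {N : ℕ} {x : k[X] × ℕ} :
    x ∈ primePowerPairs k N ↔
      (x.1.Monic ∧ x.1.natDegree ≤ N ∧ Irreducible x.1) ∧ 1 ≤ x.2 ∧ x.2 ≤ N := by
  simp only [primePowerPairs, mem_product, mem_filter, mem_biUnion, mem_range, mem_monicOfDegree,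
    mem_Icc]
  grind

lemma monicOfDegree_zero : monicOfDegree k 0 = {1} := by
  ext f
  simp only [mem_monicOfDegree, mem_singleton]
  exact ⟨fun h ↦ h.1.natDegree_eq_zero.mp h.2, by rintro rfl; simp⟩

lemma sum_monicOfDegree_one [Fintype k] {R : Type*} [AddCommMonoid R] (F : k[X] → R) :
    ∑ f ∈ monicOfDegree k 1, F f = ∑ a, F (X - C a) := by
  symm
  refine sum_bij (fun a _ ↦ X - C a) (fun a _ ↦ ?_) (fun a _ b _ h ↦ ?_) (fun f hf ↦ ?_)
    (fun _ _ ↦ rfl)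
  · simp [monic_X_sub_C]
  · simpa using h
  · rw [mem_monicOfDegree] at hf
    refine ⟨-f.coeff 0, mem_univ _, ?_⟩
    rw [hf.1.eq_X_add_C hf.2]
    simp

end MonicPolynomials

section Factorization

variable {k : Type*} [Field k]

lemma Polynomial.Monic.pow_dvd_iff_le_count_normalizedFactors [DecidableEq k] {P f : k[X]}
    (hP : P.Monic) (hirr : Irreducible P) (hf : f ≠ 0) (i : ℕ) :
    P ^ i ∣ f ↔ i ≤ (normalizedFactors f).count P := by
  rw [pow_dvd_iff_le_emultiplicity, emultiplicity_eq_count_normalizedFactors hirr hf,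
    hP.normalize_eq_self, Nat.cast_le]

lemma Polynomial.Monic.sum_natDegree_normalizedFactors [DecidableEq k] {f : k[X]} (hf : f.Monic) :
    ((normalizedFactors f).map natDegree).sum = f.natDegree := by
  classical
  have h := leadingCoeff_mul_prod_normalizedFactors f
  rw [hf.leadingCoeff, C_1, one_mul] at h
  conv_rhs => rw [← h]
  rw [natDegree_multiset_prod _ (zero_notMem_normalizedFactors _)]

open Classical in
lemma sum_natDegree_of_pow_dvd [Finite k] {N : ℕ} {f : k[X]} (hf : f.Monic) (hN : f.natDegree ≤ N) :
    ∑ x ∈ primePowerPairs k N with x.1 ^ x.2 ∣ f, x.1.natDegree = f.natDegree := by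
  have hcount (P : k[X]) (hP : P.Monic) (hirr : Irreducible P) :
      (normalizedFactors f).count P ≤ N := by
    have h := natDegree_le_of_dvd
      ((hP.pow_dvd_iff_le_count_normalizedFactors hirr hf.ne_zero _).mpr le_rfl) hf.ne_zero
    rw [natDegree_pow] at h
    exact (Nat.le_mul_of_pos_right _ hirr.natDegree_pos).trans (h.trans hN)
  rw [primePowerPairs, sum_filter, sum_product]
  have hinner : ∀ P ∈ ((range (N + 1)).biUnion (monicOfDegree k)).filter Irreducible,
      ∑ i ∈ Icc 1 N, (if P ^ i ∣ f then P.natDegree else 0) =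
        (normalizedFactors f).count P * P.natDegree := by
    intro P hP
    simp only [mem_filter, mem_biUnion, mem_monicOfDegree] at hP
    obtain ⟨⟨_, _, hmon, _⟩, hirr⟩ := hP
    rw [← sum_filter, sum_const, smul_eq_mul]
    congr 1
    have : (Icc 1 N).filter (fun i ↦ P ^ i ∣ f) = Icc 1 ((normalizedFactors f).count P) := by
      ext i
      have := hcount P hmon hirr
      simp only [mem_filter, mem_Icc, hmon.pow_dvd_iff_le_count_normalizedFactors hirr hf.ne_zero]
      lia
    rw [this, Nat.card_Icc, Nat.add_sub_cancel]
  rw [sum_congr rfl hinner, ← hf.sum_natDegree_normalizedFactors, sum_multiset_map_count]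
  symm
  refine sum_subset (fun P hP ↦ ?_) (fun P _ hP ↦ ?_)
  · rw [Multiset.mem_toFinset] at hP
    have hirr := irreducible_of_normalized_factor P hP
    have hmon : P.Monic := by
      rw [← normalize_normalized_factor P hP]
      exact monic_normalize hirr.ne_zero
    have hdeg := natDegree_le_of_dvd (dvd_of_mem_normalizedFactors hP) hf.ne_zero
    simp only [mem_filter, mem_biUnion, mem_range, mem_monicOfDegree]
    exact ⟨⟨P.natDegree, by lia, hmon, rfl⟩, hirr⟩
  · rw [Multiset.mem_toFinset] at hP
    simp [hP]

end Factorization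

section EulerProduct

variable {k : Type*} [Field k] [Finite k] {R : Type*} [CommRing R] {F : k[X] → R}

open Classical in
lemma sum_monicOfDegree_dvd (hF : ∀ f g : k[X], f.Monic → g.Monic → F (f * g) = F f * F g)
    {Q : k[X]} (hQ : Q.Monic) (d : ℕ) :
    ∑ f ∈ monicOfDegree k d with Q ∣ f, F f =
      if Q.natDegree ≤ d then F Q * ∑ g ∈ monicOfDegree k (d - Q.natDegree), F g else 0 := by
  split_ifs with h
  · rw [mul_sum]
    symm
    refine sum_bij (fun g _ ↦ Q * g) (fun g hg ↦ ?_) (fun g _ g' _ h ↦ ?_) (fun f hf ↦ ?_)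
      (fun g hg ↦ ?_)
    · rw [mem_monicOfDegree] at hg
      simp only [mem_filter, mem_monicOfDegree, hQ.mul hg.1, hQ.natDegree_mul hg.1, hg.2,
        dvd_mul_right, and_true, true_and]
      lia
    · exact mul_left_cancel₀ hQ.ne_zero h
    · simp only [mem_filter, mem_monicOfDegree] at hf
      obtain ⟨⟨hf, hd⟩, g, rfl⟩ := hf
      have hg := hQ.of_mul_monic_left hf
      rw [hQ.natDegree_mul hg] at hd
      exact ⟨g, by simp only [mem_monicOfDegree, hg, true_and]; lia, rfl⟩
    · rw [hF _ _ hQ (mem_monicOfDegree.mp hg).1]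
  · refine sum_eq_zero fun f hf ↦ absurd ?_ h
    simp only [mem_filter, mem_monicOfDegree] at hf
    rw [← hf.1.2]
    exact natDegree_le_of_dvd hf.2 hf.1.1.ne_zero

/-- The coefficients of the logarithmic derivative of the Euler product attached to `F`, computed
from prime powers of degree at most `N`. -/
noncomputable def primePowerSum (F : k[X] → R) (N j : ℕ) : R :=
  ∑ x ∈ primePowerPairs k N with x.2 * x.1.natDegree = j, x.1.natDegree • F (x.1 ^ x.2)

lemma nsmul_sum_monicOfDegree
    (hF : ∀ f g : k[X], f.Monic → g.Monic → F (f * g) = F f * F g) {d N : ℕ} (hd : d ≤ N) :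
    d • ∑ f ∈ monicOfDegree k d, F f =
      ∑ j ∈ Icc 1 d, primePowerSum F N j * ∑ g ∈ monicOfDegree k (d - j), F g := by
  classical
  have hleft : d • ∑ f ∈ monicOfDegree k d, F f = ∑ x ∈ primePowerPairs k N,
      x.1.natDegree • ∑ f ∈ monicOfDegree k d with x.1 ^ x.2 ∣ f, F f := by
    simp_rw [smul_sum, sum_filter]
    rw [sum_comm]
    refine sum_congr rfl fun f hf ↦ ?_
    obtain ⟨hmon, rfl⟩ := mem_monicOfDegree.mp hf
    conv_lhs => rw [← sum_natDegree_of_pow_dvd hmon hd]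
    rw [← sum_filter, sum_smul]
  rw [hleft]
  simp_rw [primePowerSum, sum_mul, sum_filter]
  rw [sum_comm]
  refine sum_congr rfl fun x hx ↦ ?_
  rw [mem_primePowerPairs] at hx
  rw [← sum_filter, sum_monicOfDegree_dvd hF (hx.1.1.pow _), natDegree_pow, sum_ite_eq]
  have := Nat.mul_pos hx.2.1 hx.1.2.2.natDegree_pos
  simp only [mem_Icc, Nat.succ_le_of_lt this, true_and]
  split_ifs <;> simp [mul_assoc]

lemma primePowerSum_eq (hF : ∀ f g : k[X], f.Monic → g.Monic → F (f * g) = F f * F g)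
    (hone : F 1 = 1) (hzero : ∀ d, 2 ≤ d → ∑ f ∈ monicOfDegree k d, F f = 0)
    {d N : ℕ} (hdN : d + 1 ≤ N) :
    primePowerSum F N (d + 1) = (-1) ^ d * (∑ f ∈ monicOfDegree k 1, F f) ^ (d + 1) := by
  induction d with
  | zero =>
    have h := nsmul_sum_monicOfDegree hF hdN
    simpa [monicOfDegree_zero, hone] using h.symm
  | succ d ih =>
    have h := nsmul_sum_monicOfDegree hF hdN
    rw [hzero _ (by lia), smul_zero, sum_Icc_succ_top (by lia), sum_Icc_succ_top (by lia),
      sum_eq_zero, ih (by lia)] at h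
    · rw [show d + 1 + 1 - (d + 1) = 1 by lia, Nat.sub_self, monicOfDegree_zero, sum_singleton,
        hone] at h
      linear_combination -h
    · intro j hj
      rw [mem_Icc] at hj
      rw [hzero _ (by lia), mul_zero]

end EulerProduct

section KloostermanTerm

variable {k : Type*} [Field k]

/-- The element `ψ(c₁)[c_d]` of the monoid algebra of `k` attached to a monic polynomial
`X ^ d - c₁ X ^ (d - 1) + ⋯ + (-1) ^ d c_d`. -/
noncomputable def kloostermanTerm (ψ : AddChar k ℂ) (f : k[X]) : MonoidAlgebra ℂ k :=
  .single ((-1) ^ f.natDegree * f.coeff 0) (ψ (-f.nextCoeff))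

lemma kloostermanTerm_one (ψ : AddChar k ℂ) : kloostermanTerm ψ 1 = 1 := by
  simp [kloostermanTerm, MonoidAlgebra.one_def, nextCoeff]

lemma kloostermanTerm_mul (ψ : AddChar k ℂ) {f g : k[X]} (hf : f.Monic) (hg : g.Monic) :
    kloostermanTerm ψ (f * g) = kloostermanTerm ψ f * kloostermanTerm ψ g := by
  rw [kloostermanTerm, kloostermanTerm, kloostermanTerm, MonoidAlgebra.single_mul_single,
    hf.natDegree_mul hg, mul_coeff_zero, hf.nextCoeff_mul hg, neg_add, AddChar.map_add_eq_mul]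
  congr 1
  ring

lemma kloostermanTerm_pow (ψ : AddChar k ℂ) {f : k[X]} (hf : f.Monic) (i : ℕ) :
    kloostermanTerm ψ (f ^ i) = kloostermanTerm ψ f ^ i := by
  induction i with
  | zero => simp [kloostermanTerm_one]
  | succ i ih => rw [pow_succ, kloostermanTerm_mul ψ (hf.pow i) hf, ih, pow_succ]

lemma sum_kloostermanTerm_eq_zero [Finite k] {ψ : AddChar k ℂ} (hψ : ψ ≠ 1) {d : ℕ}
    (hd : 2 ≤ d) : ∑ f ∈ monicOfDegree k d, kloostermanTerm ψ f = 0 := by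
  obtain ⟨t, ht⟩ := AddChar.ne_one_iff.mp hψ
  have hdeg (s : k) : (C s * X ^ (d - 1) : k[X]).degree < (d : WithBot ℕ) :=
    (degree_C_mul_X_pow_le _ _).trans_lt (Nat.cast_lt.mpr (by lia))
  have hmem (s : k) (f : k[X]) (hf : f ∈ monicOfDegree k d) :
      f + C s * X ^ (d - 1) ∈ monicOfDegree k d := by
    obtain ⟨hmon, rfl⟩ := mem_monicOfDegree.mp hf
    have hlt : (C s * X ^ (f.natDegree - 1)).degree < f.degree := by
      rw [degree_eq_natDegree hmon.ne_zero]
      exact hdeg s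
    exact mem_monicOfDegree.mpr ⟨hmon.add_of_left hlt, natDegree_add_eq_left_of_degree_lt hlt⟩
  have hshift : ∑ f ∈ monicOfDegree k d, kloostermanTerm ψ f =
      ψ t • ∑ f ∈ monicOfDegree k d, kloostermanTerm ψ f := by
    rw [smul_sum]
    refine sum_bij' (fun f _ ↦ f + C t * X ^ (d - 1)) (fun f _ ↦ f + C (-t) * X ^ (d - 1))
      (hmem t) (hmem (-t)) (fun f _ ↦ by simp) (fun f _ ↦ by simp) (fun f hf ↦ ?_)
    have hnat := (mem_monicOfDegree.mp hf).2
    have hnat' := (mem_monicOfDegree.mp (hmem t f hf)).2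
    rw [kloostermanTerm, kloostermanTerm, MonoidAlgebra.smul_single, hnat, hnat',
      nextCoeff_of_natDegree_pos (by lia), nextCoeff_of_natDegree_pos (by lia), hnat, hnat']
    have h0 : (C t * X ^ (d - 1)).coeff 0 = 0 := by
      rw [coeff_C_mul_X_pow, if_neg (by lia)]
    rw [coeff_add, h0, add_zero, coeff_add, coeff_C_mul_X_pow, if_pos rfl, smul_eq_mul,
      ← AddChar.map_add_eq_mul]
    congr 2
    ring
  have hzero : (1 - ψ t) • ∑ f ∈ monicOfDegree k d, kloostermanTerm ψ f = 0 := by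
    rw [sub_smul, one_smul, ← hshift, sub_self]
  exact (smul_eq_zero.mp hzero).resolve_left (sub_ne_zero.mpr (Ne.symm ht))

lemma sum_kloostermanTerm_monicOfDegree_one [Fintype k] (ψ : AddChar k ℂ) :
    ∑ f ∈ monicOfDegree k 1, kloostermanTerm ψ f = ∑ a, MonoidAlgebra.single a (ψ a) := by
  rw [sum_monicOfDegree_one]
  refine sum_congr rfl fun a _ ↦ ?_
  simp [kloostermanTerm]

lemma coeff_sum_single_pow [Fintype k] [DecidableEq k] (ψ : AddChar k ℂ) (n : ℕ) (l : kˣ) :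
    ((∑ a, MonoidAlgebra.single a (ψ a)) ^ n : MonoidAlgebra ℂ k).coeff l =
      kloosterman ψ n l := by
  have hprod (ζ : Fin n → k) : ∏ i, MonoidAlgebra.single (ζ i) (ψ (ζ i)) =
      MonoidAlgebra.single (∏ i, ζ i) (ψ (∑ i, ζ i)) := by
    have hψ : ψ (∑ i, ζ i) = ∏ i, ψ (ζ i) := by
      simpa [← ofAdd_sum] using map_prod ψ.toMonoidHom (fun i ↦ Multiplicative.ofAdd (ζ i)) univ
    rw [hψ]
    simp
  rw [Fintype.sum_pow, MonoidAlgebra.coeff_sum, Finsupp.finsetSum_apply]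
  simp_rw [hprod, MonoidAlgebra.coeff_single, Finsupp.single_apply]
  rw [← sum_filter, kloosterman]
  symm
  refine sum_bij (fun ζ _ i ↦ (ζ i : k)) (fun ζ hζ ↦ by simpa using hζ)
    (fun ζ _ ξ _ h ↦ funext fun i ↦ Units.ext (congrFun h i)) (fun ζ hζ ↦ ?_) (fun _ _ ↦ rfl)
  have hζ' : ∏ i, ζ i = l := by simpa using hζ
  have hne (i : Fin n) : ζ i ≠ 0 := fun h ↦
    l.ne_zero (hζ' ▸ prod_eq_zero (mem_univ i) h)
  exact ⟨fun i ↦ Units.mk0 (ζ i) (hne i), by simpa using hζ', rfl⟩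

end KloostermanTerm

section FiniteExtension

variable {k L : Type*} [Field k] [Field L] [Algebra k L]

open IntermediateField in
lemma single_norm_trace_eq_kloostermanTerm_pow [FiniteDimensional k L] (ψ : AddChar k ℂ) (y : L) :
    MonoidAlgebra.single (Algebra.norm k y) (ψ (Algebra.trace k L y)) =
      kloostermanTerm ψ (minpoly k y) ^ Module.finrank k⟮y⟯ L := by
  have hy : IsIntegral k y := .of_finite k y
  have hnorm : Algebra.norm k (AdjoinSimple.gen k y) =
      (-1) ^ (minpoly k y).natDegree * (minpoly k y).coeff 0 := by
    simpa [minpoly_gen k y] using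
      Algebra.PowerBasis.norm_gen_eq_coeff_zero_minpoly (adjoin.powerBasis hy)
  rw [kloostermanTerm, MonoidAlgebra.single_pow, ← hnorm, ← Algebra.norm_eq_norm_adjoin,
    trace_eq_finrank_mul_minpoly_nextCoeff, ← nsmul_eq_mul, AddChar.map_nsmul_eq_pow]

lemma Irreducible.splits_map_of_natDegree_dvd_finrank [Finite L] {P : k[X]}
    (hP : Irreducible P) (hdvd : P.natDegree ∣ Module.finrank k L) :
    (P.map (algebraMap k L)).Splits := by
  have := Fintype.ofFinite L
  have : Finite k := Finite.of_injective _ (algebraMap k L).injective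
  have hne : (X ^ Fintype.card L - X : k[X]) ≠ 0 :=
    FiniteField.X_pow_card_sub_X_ne_zero k Fintype.one_lt_card
  refine (IsSplittingField.splits L (X ^ Fintype.card L - X : k[X])).of_dvd
    (map_ne_zero hne) (map_dvd (mapRingHom (algebraMap k L)) ?_)
  rw [Fintype.card_eq_nat_card, Module.natCard_eq_pow_finrank (K := k)]
  exact hP.natDegree_dvd_iff_dvd_X_pow_card_pow_sub_X.mp hdvd

lemma card_filter_minpoly_eq [Fintype L] [DecidableEq k[X]] {P : k[X]} (hmon : P.Monic)
    (hP : Irreducible P) (hdvd : P.natDegree ∣ Module.finrank k L) :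
    #{y : L | minpoly k y = P} = P.natDegree := by
  classical
  have : Finite k := Finite.of_injective _ (algebraMap k L).injective
  rw [← card_rootSet_eq_natDegree (K := L) (PerfectField.separable_of_irreducible hP)
    (hP.splits_map_of_natDegree_dvd_finrank hdvd), ← Set.toFinset_card]
  congr 1
  ext y
  simp only [mem_filter, mem_univ, true_and, Set.mem_toFinset, mem_rootSet, ne_eq, hmon.ne_zero,
    not_false_eq_true]
  exact ⟨fun h ↦ h ▸ minpoly.aeval k y,
    fun h ↦ (minpoly.eq_of_irreducible_of_monic hP h hmon).symm⟩

open IntermediateField in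
lemma sum_single_norm_eq_primePowerSum [Fintype L] [Finite k] (ψ : AddChar k ℂ) :
    ∑ y : L, MonoidAlgebra.single (Algebra.norm k y) (ψ (Algebra.trace k L y)) =
      primePowerSum (kloostermanTerm ψ) (Module.finrank k L) (Module.finrank k L) := by
  classical
  have hmul (y : L) : Module.finrank k⟮y⟯ L * (minpoly k y).natDegree = Module.finrank k L := by
    rw [← adjoin.finrank (.of_finite k y), mul_comm, Module.finrank_mul_finrank]
  have hpos : 0 < Module.finrank k L := Module.finrank_pos
  have hmaps : ∀ y ∈ (univ : Finset L), (minpoly k y, Module.finrank k⟮y⟯ L) ∈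
      {x ∈ primePowerPairs k (Module.finrank k L) | x.2 * x.1.natDegree = Module.finrank k L} := by
    intro y _
    rw [mem_filter, mem_primePowerPairs]
    have hy : IsIntegral k y := .of_finite k y
    exact ⟨⟨⟨minpoly.monic hy, Nat.le_of_dvd hpos (Dvd.intro_left _ (hmul y)),
      minpoly.irreducible hy⟩, Module.finrank_pos,
      Nat.le_of_dvd hpos (Dvd.intro _ (hmul y))⟩, hmul y⟩
  rw [← sum_fiberwise_of_maps_to hmaps, primePowerSum]
  refine sum_congr rfl fun x hx ↦ ?_
  rw [mem_filter, mem_primePowerPairs] at hx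
  obtain ⟨⟨⟨hmon, -, hirr⟩, -⟩, hdeg⟩ := hx
  have hfiber : ({y | (minpoly k y, Module.finrank k⟮y⟯ L) = x} : Finset L) =
      ({y | minpoly k y = x.1} : Finset L) := by
    ext y
    simp only [mem_filter, mem_univ, true_and]
    refine ⟨fun h ↦ congrArg Prod.fst h, fun h ↦ Prod.ext h ?_⟩
    exact Nat.eq_of_mul_eq_mul_right hirr.natDegree_pos (by rw [hdeg, ← hmul y, h])
  rw [← card_filter_minpoly_eq (L := L) hmon hirr (Dvd.intro_left _ hdeg), ← hfiber, ← sum_const]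
  refine sum_congr rfl fun y hy ↦ ?_
  rw [single_norm_trace_eq_kloostermanTerm_pow, ← (mem_filter.mp hy).2,
    kloostermanTerm_pow ψ (minpoly.monic (.of_finite k y))]

end FiniteExtension

/-- for a degree-`n` extension `kₙ/k` of finite fields,
`∑_{y ∈ kₙ^×, N(y) = l} ψ(Tr(y)) = (-1)^(n-1) K_{n,l}(ψ)`. -/
theorem sum_psi_trace_over_norm_fiber
    {k kn : Type*} [Field k] [Fintype k] [DecidableEq k]
    [Field kn] [Fintype kn] [DecidableEq kn] [Algebra k kn]
    (n : ℕ) (hn : 0 < n) (hdeg : Module.finrank k kn = n)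
    (ψ : AddChar k ℂ) (hψ : ψ ≠ 1) (l : kˣ) :
    ∑ y ∈ Finset.univ.filter (fun y : knˣ => Algebra.norm k (y : kn) = (l : k)),
        ψ (Algebra.trace k kn (y : kn))
      = (-1 : ℂ) ^ (n - 1) * kloosterman (⇑ψ) n l := by
  have hkey := sum_single_norm_eq_primePowerSum (k := k) (L := kn) ψ
  obtain ⟨m, rfl⟩ : ∃ m, n = m + 1 := ⟨n - 1, by lia⟩
  rw [hdeg, primePowerSum_eq (fun f g ↦ kloostermanTerm_mul ψ) (kloostermanTerm_one ψ)
    (fun d ↦ sum_kloostermanTerm_eq_zero hψ) le_rfl,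
    sum_kloostermanTerm_monicOfDegree_one] at hkey
  have hcoeff := congrArg (fun x : MonoidAlgebra ℂ k ↦ x.coeff (l : k)) hkey
  have hsign : ((-1) ^ m : MonoidAlgebra ℂ k) = MonoidAlgebra.single 1 ((-1) ^ m) := by
    rw [← one_pow (M := k) m, ← MonoidAlgebra.single_pow, MonoidAlgebra.single_neg,
      ← MonoidAlgebra.one_def]
  simp only [hsign, MonoidAlgebra.coeff_single_one_mul, coeff_sum_single_pow,
    MonoidAlgebra.coeff_sum, Finsupp.finsetSum_apply, MonoidAlgebra.coeff_single,
    Finsupp.single_apply] at hcoeff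
  rw [Nat.add_sub_cancel, ← hcoeff, ← sum_filter]
  refine sum_bij (fun y _ ↦ (y : kn)) (fun y hy ↦ by simpa using hy)
    (fun _ _ _ _ h ↦ Units.ext h) (fun y hy ↦ ?_) (fun _ _ ↦ rfl)
  have hy' : Algebra.norm k y = l := by simpa using hy
  have hne : y ≠ 0 := Algebra.norm_ne_zero_iff.mp (hy' ▸ l.ne_zero)
  exact ⟨Units.mk0 y hne, by simpa using hy', rfl⟩
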